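/- arXiv:2307.09039 — 2 statements merged into one kernel-verified Lean document; each statement's English description precedes it below -/
import Mathlib

section
/- With the data of the general hybrid splitting scheme with relaxation (Algorithm 6), the scheme is first-order accurate: there exist a constant C > 0 and N₀ ∈ ℕ such that for all N ≥ N₀ and all 0 ≤ n ≤ N, the scheme iterates u^n and the exact solution u of the linear ODE satisfy ‖u^n − u(nΔt)‖ ≤ C·Δt, where Δt = T/N. -/
open Finset

/-- Apply a `d × d` real matrix to a vector of `EuclideanSpace ℝ (Fin d)`
(so that norms are Euclidean norms). -/
noncomputable def matApp {d : ℕ} (A : Matrix (Fin d) (Fin d) ℝ)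
    (v : EuclideanSpace ℝ (Fin d)) : EuclideanSpace ℝ (Fin d) :=
  Matrix.toEuclideanCLM (𝕜 := ℝ) A v

/-- The `M_j` substeps performed at one grid level of Algorithm 6.  `pow` is the factor
(`2^{j−1}` in the left branch, `2^{2J−j}` in the right branch), `cj m = c_{j,m}`
(with `cj 0` the channel count of the input), `Am m k s`, `Sm m k`, `fm m k` are the data
already evaluated at the relevant times, and `init` is the pair
(input average, input channels).  The value at `m` is the pair
`(u^{n,j,m}, k ↦ u^{n,j,m}_k)`. -/
noncomputable def levelSub (d : ℕ) (pow : ℝ) (cj : ℕ → ℕ)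
    (Am : ℕ → ℕ → ℕ → Matrix (Fin d) (Fin d) ℝ)
    (Sm : ℕ → ℕ → Matrix (Fin d) (Fin d) ℝ)
    (fm : ℕ → ℕ → EuclideanSpace ℝ (Fin d))
    (Δt : ℝ)
    (init : EuclideanSpace ℝ (Fin d) × (ℕ → EuclideanSpace ℝ (Fin d))) :
    ℕ → EuclideanSpace ℝ (Fin d) × (ℕ → EuclideanSpace ℝ (Fin d))
  | 0 => init
  | (m + 1) =>
      let prev := levelSub d pow cj Am Sm fm Δt init m
      let uk : ℕ → EuclideanSpace ℝ (Fin d) := fun k =>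
        matApp ((1 + (pow * (cj (m + 1) : ℝ) * Δt) • Sm (m + 1) k)⁻¹)
          (prev.1 - (pow * (cj (m + 1) : ℝ) * Δt) •
            ((∑ s ∈ Finset.Icc 1 (cj m), matApp (Am (m + 1) k s) (prev.2 s))
              + fm (m + 1) k))
      (((cj (m + 1) : ℝ))⁻¹ • ∑ k ∈ Finset.Icc 1 (cj (m + 1)), uk k, uk)

/-- The left branch of Algorithm 6: `alg6Left … j = (u^{n,j,M_j}, k ↦ u^{n,j,M_j}_k)`
(for `j = 0` it is the initial data `(u^n, k ↦ u^n)`). -/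
noncomputable def alg6Left (d : ℕ) (M : ℕ → ℕ) (c : ℕ → ℕ → ℕ)
    (A : ℕ → ℕ → ℕ → ℕ → ℝ → Matrix (Fin d) (Fin d) ℝ)
    (S : ℕ → ℕ → ℕ → ℝ → Matrix (Fin d) (Fin d) ℝ)
    (f : ℕ → ℕ → ℕ → ℝ → EuclideanSpace ℝ (Fin d))
    (Δt tn tn1 : ℝ) (un : EuclideanSpace ℝ (Fin d)) :
    ℕ → EuclideanSpace ℝ (Fin d) × (ℕ → EuclideanSpace ℝ (Fin d))
  | 0 => (un, fun _ => un)
  | (j + 1) =>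
      levelSub d ((2 : ℝ) ^ j) (c (j + 1))
        (fun m k s => A (j + 1) m k s tn)
        (fun m k => S (j + 1) m k tn1)
        (fun m k => f (j + 1) m k tn)
        Δt (alg6Left d M c A S f Δt tn tn1 un j) (M (j + 1))

/-- The right branch of Algorithm 6 including the relaxation steps:
`alg6Right … J i = (ū^{n,J+i,M_{J+i}}, k ↦ ū^{n,J+i,M_{J+i}}_k)` for `0 ≤ i ≤ J−1`. -/
noncomputable def alg6Right (d J : ℕ) (M : ℕ → ℕ) (c : ℕ → ℕ → ℕ)
    (A : ℕ → ℕ → ℕ → ℕ → ℝ → Matrix (Fin d) (Fin d) ℝ)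
    (S : ℕ → ℕ → ℕ → ℝ → Matrix (Fin d) (Fin d) ℝ)
    (f : ℕ → ℕ → ℕ → ℝ → EuclideanSpace ℝ (Fin d))
    (Δt tn tn1 : ℝ) (un : EuclideanSpace ℝ (Fin d)) :
    ℕ → EuclideanSpace ℝ (Fin d) × (ℕ → EuclideanSpace ℝ (Fin d))
  | 0 => alg6Left d M c A S f Δt tn tn1 un J
  | (i + 1) =>
      let j := J + i + 1
      let s := levelSub d ((2 : ℝ) ^ (2 * J - j)) (c j)
        (fun m k s => A j m k s tn)
        (fun m k => S j m k tn1)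
        (fun m k => f j m k tn)
        Δt (alg6Right d J M c A S f Δt tn tn1 un i) (M j)
      let relax : ℕ → EuclideanSpace ℝ (Fin d) := fun k =>
        (1 / 2 : ℝ) • s.2 k
          + (1 / 2 : ℝ) • (alg6Left d M c A S f Δt tn tn1 un (2 * J - j)).2 k
      (((c j (M j) : ℝ))⁻¹ • ∑ k ∈ Finset.Icc 1 (c j (M j)), relax k, relax)

/-- One full step `u^n ↦ u^{n+1}` of the general hybrid splitting scheme with relaxation
(Algorithm 6). -/
noncomputable def alg6Step (d J : ℕ) (M : ℕ → ℕ) (c : ℕ → ℕ → ℕ)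
    (A : ℕ → ℕ → ℕ → ℕ → ℝ → Matrix (Fin d) (Fin d) ℝ)
    (S : ℕ → ℕ → ℕ → ℝ → Matrix (Fin d) (Fin d) ℝ)
    (f : ℕ → ℕ → ℕ → ℝ → EuclideanSpace ℝ (Fin d))
    (Astar : ℕ → ℝ → Matrix (Fin d) (Fin d) ℝ)
    (Sstar : ℝ → Matrix (Fin d) (Fin d) ℝ)
    (fstar : ℝ → EuclideanSpace ℝ (Fin d))
    (Δt tn tn1 : ℝ) (un : EuclideanSpace ℝ (Fin d)) : EuclideanSpace ℝ (Fin d) :=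
  let ubar := alg6Right d J M c A S f Δt tn tn1 un (J - 1)
  matApp ((1 + Δt • Sstar tn1)⁻¹)
    (ubar.1 - Δt •
      ((∑ s ∈ Finset.Icc 1 (c (2 * J - 1) (M (2 * J - 1))), matApp (Astar s tn) (ubar.2 s))
        + fstar tn))

open Asymptotics Filter

section Expansion

variable {α E : Type*} [NormedAddCommGroup E] {l : Filter α}

theorem isBigO_one_add_norm (v : α → E) : v =O[l] fun p => 1 + ‖v p‖ :=
  IsBigO.of_bound 1 (Eventually.of_forall fun p => by
    rw [Real.norm_of_nonneg (by positivity)]; linarith)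

theorem one_isBigO_one_add_norm (v : α → E) :
    (fun _ => (1 : ℝ)) =O[l] fun p => 1 + ‖v p‖ :=
  IsBigO.of_bound 1 (Eventually.of_forall fun p => by
    rw [Real.norm_of_nonneg (r := 1 + ‖v p‖) (by positivity)]
    simp)

variable [NormedSpace ℝ E]

theorem isBigO_clm_apply {B : α → E →L[ℝ] E} {x : α → E} {b g : α → ℝ}
    (hB : B =O[l] b) (hx : x =O[l] g) :
    (fun p => B p (x p)) =O[l] fun p => b p * g p := by
  have h : (fun p => B p (x p)) =O[l] fun p => ‖B p‖ * ‖x p‖ :=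
    IsBigO.of_bound 1 (Eventually.of_forall fun p => by
      simpa using (B p).le_opNorm (x p))
  exact h.trans (hB.norm_left.mul hx.norm_left)

/-- First-order expansion of a semi-implicit Euler substep `z + a Δt S₁ z = w - a Δt (∑ A wₛ + f)`
whose inputs `w`, `wₛ` are themselves expanded around `v`. -/
theorem semiImplicit_expansion {ι : Type*} {dt : α → ℝ} {v w H z : α → E} {a : ℝ}
    {s : Finset ι} {B : ι → α → E →L[ℝ] E} {ws : ι → α → E} {S₁ S₀ : α → E →L[ℝ] E}
    {f : α → E}
    (hdt : dt =O[l] fun _ => (1 : ℝ))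
    (hw : (fun p => w p - v p + dt p • H p) =O[l] fun p => dt p * (dt p * (1 + ‖v p‖)))
    (hH : H =O[l] fun p => 1 + ‖v p‖)
    (hws : ∀ i ∈ s, (fun p => ws i p - v p) =O[l] fun p => dt p * (1 + ‖v p‖))
    (hB : ∀ i ∈ s, B i =O[l] fun _ => (1 : ℝ))
    (hS₁ : S₁ =O[l] fun _ => (1 : ℝ))
    (hS : (fun p => S₁ p - S₀ p) =O[l] dt)
    (hf : f =O[l] fun _ => (1 : ℝ))
    (hz : ∀ᶠ p in l, z p + (a * dt p) • S₁ p (z p)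
      = w p - (a * dt p) • ((∑ i ∈ s, B i p (ws i p)) + f p))
    (hzw : ∀ᶠ p in l, ‖z p‖ ≤ ‖w p - (a * dt p) • ((∑ i ∈ s, B i p (ws i p)) + f p)‖) :
    (fun p => z p - v p + dt p • (H p + a • ((∑ i ∈ s, B i p (v p)) + S₀ p (v p) + f p)))
        =O[l] (fun p => dt p * (dt p * (1 + ‖v p‖))) ∧
      (fun p => z p - v p) =O[l] (fun p => dt p * (1 + ‖v p‖)) ∧
      (fun p => H p + a • ((∑ i ∈ s, B i p (v p)) + S₀ p (v p) + f p))
        =O[l] fun p => 1 + ‖v p‖ := by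
  have hv := isBigO_one_add_norm (l := l) v
  have hfg := hf.trans (one_isBigO_one_add_norm v)
  have lower : ∀ {g : α → ℝ}, (fun p => dt p * g p) =O[l] g := fun {g} => by
    simpa using hdt.mul (isBigO_refl g l)
  have hdtr := isBigO_refl dt l
  have hadt : (fun p => a * dt p) =O[l] dt := hdtr.const_mul_left a
  have hBv : (fun p => ∑ i ∈ s, B i p (v p)) =O[l] fun p => 1 + ‖v p‖ :=
    IsBigO.fun_sum fun i hi => by simpa using isBigO_clm_apply (hB i hi) hv
  have hBd : (fun p => ∑ i ∈ s, B i p (ws i p - v p)) =O[l] fun p => dt p * (1 + ‖v p‖) :=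
    IsBigO.fun_sum fun i hi => by simpa using isBigO_clm_apply (hB i hi) (hws i hi)
  have hS₀ : S₀ =O[l] fun _ => (1 : ℝ) := by
    simpa using hS₁.sub (hS.trans hdt)
  have hS₀v : (fun p => S₀ p (v p)) =O[l] fun p => 1 + ‖v p‖ := by
    simpa using isBigO_clm_apply hS₀ hv
  set y := fun p => w p - (a * dt p) • ((∑ i ∈ s, B i p (ws i p)) + f p) with hy
  have hyexp : (fun p => y p - v p + dt p • (H p + a • ((∑ i ∈ s, B i p (v p)) + f p)))
      =O[l] fun p => dt p * (dt p * (1 + ‖v p‖)) := by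
    refine (hw.sub (hadt.smul hBd)).congr_left fun p => ?_
    simp only [hy, map_sub, Finset.sum_sub_distrib]
    module
  have hyv : (fun p => y p - v p) =O[l] fun p => dt p * (1 + ‖v p‖) := by
    have h := (hyexp.trans lower).sub
      (hdtr.smul (hH.add ((hBv.add hfg).const_smul_left a)))
    exact h.congr_left fun p => by simp
  have hyO : y =O[l] fun p => 1 + ‖v p‖ := by
    simpa using (hyv.trans lower).add hv
  have hzO : z =O[l] fun p => 1 + ‖v p‖ :=
    (IsBigO.of_bound 1 (by simpa only [one_mul] using hzw)).trans hyO
  have hzy : (fun p => (a * dt p) • S₁ p (z p)) =O[l] fun p => dt p * (1 + ‖v p‖) := by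
    simpa using hadt.smul (isBigO_clm_apply hS₁ hzO)
  have hzv : (fun p => z p - v p) =O[l] fun p => dt p * (1 + ‖v p‖) := by
    refine (hyv.sub hzy).congr' ?_ EventuallyEq.rfl
    filter_upwards [hz] with p hp
    simp only [hy, ← hp]
    abel
  refine ⟨?_, hzv, hH.add (((hBv.add hS₀v).add hfg).const_smul_left a)⟩
  have h1 : (fun p => (a * dt p) • S₁ p (z p - v p))
      =O[l] fun p => dt p * (dt p * (1 + ‖v p‖)) := by
    simpa using hadt.smul (isBigO_clm_apply hS₁ hzv)
  have h2 : (fun p => (a * dt p) • (S₁ p - S₀ p) (v p))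
      =O[l] fun p => dt p * (dt p * (1 + ‖v p‖)) := by
    simpa using hadt.smul (isBigO_clm_apply hS hv)
  refine ((hyexp.sub h1).sub h2).congr' ?_ EventuallyEq.rfl
  filter_upwards [hz] with p hp
  have hyp : y p = z p + (a * dt p) • S₁ p (z p) := hp.symm
  simp only [hyp, map_sub, sub_apply]
  module

/-- The state `w` (average and channels) of the scheme satisfies
`w.1 = v - Δt H + O(Δt²)`, and its first `N` channels are `v + O(Δt)`. -/
structure FirstOrderExpansion (l : Filter α) (dt : α → ℝ) (v : α → E) (N : ℕ)
    (w : α → E × (ℕ → E)) (H : α → E) : Prop where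
  average : (fun p => (w p).1 - v p + dt p • H p) =O[l] fun p => dt p * (dt p * (1 + ‖v p‖))
  channel : ∀ s ∈ Icc 1 N, (fun p => (w p).2 s - v p) =O[l] fun p => dt p * (1 + ‖v p‖)
  slope : H =O[l] fun p => 1 + ‖v p‖

end Expansion

section Matrix

variable {d : ℕ}

theorem one_add_smul_posDef {S : Matrix (Fin d) (Fin d) ℝ} (hS : S.PosDef) {τ : ℝ}
    (hτ : 0 ≤ τ) : (1 + τ • S).PosDef :=
  Matrix.PosDef.one.add_posSemidef (hS.posSemidef.smul hτ)

theorem matApp_resolvent_eq {S : Matrix (Fin d) (Fin d) ℝ} (hS : S.PosDef) {τ : ℝ}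
    (hτ : 0 ≤ τ) (y : EuclideanSpace ℝ (Fin d)) :
    matApp (1 + τ • S)⁻¹ y + τ • matApp S (matApp (1 + τ • S)⁻¹ y) = y := by
  have hu : IsUnit (1 + τ • S).det :=
    (Matrix.isUnit_iff_isUnit_det _).1 (one_add_smul_posDef hS hτ).isUnit
  have h : matApp (1 + τ • S) (matApp (1 + τ • S)⁻¹ y) = y := by
    unfold matApp
    rw [← mul_apply_eq_comp, ← map_mul, Matrix.mul_nonsing_inv _ hu]
    simp
  simpa [matApp] using h

theorem norm_matApp_resolvent_le {S : Matrix (Fin d) (Fin d) ℝ} (hS : S.PosDef) {τ : ℝ}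
    (hτ : 0 ≤ τ) (y : EuclideanSpace ℝ (Fin d)) :
    ‖matApp (1 + τ • S)⁻¹ y‖ ≤ ‖y‖ := by
  set z := matApp (1 + τ • S)⁻¹ y with hz
  have hy : z + τ • matApp S z = y := matApp_resolvent_eq hS hτ y
  have hpos : 0 ≤ inner ℝ z (matApp S z) := by
    have := hS.posSemidef.dotProduct_mulVec_nonneg z.ofLp
    simpa [matApp, EuclideanSpace.inner_eq_star_dotProduct, dotProduct_comm] using this
  have h : ‖z‖ * ‖z‖ ≤ ‖z‖ * ‖y‖ := by
    refine le_trans ?_ (real_inner_le_norm z y)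
    rw [← hy, inner_add_right, inner_smul_right, real_inner_self_eq_norm_mul_norm]
    nlinarith [mul_nonneg hτ hpos]
  rcases (norm_nonneg z).eq_or_lt with h0 | h0
  · rw [← h0]; exact norm_nonneg y
  · exact le_of_mul_le_mul_left h h0

end Matrix

section Average

variable {E : Type*} [AddCommGroup E] [Module ℝ E] {n : ℕ}

theorem inv_smul_sum_Icc_const (hn : 1 ≤ n) (x : E) :
    (n : ℝ)⁻¹ • ∑ _k ∈ Icc 1 n, x = x := by
  have hc : (n : ℝ) ≠ 0 := by positivity
  rw [sum_const, Nat.card_Icc, Nat.add_sub_cancel, ← Nat.cast_smul_eq_nsmul ℝ, smul_smul,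
    inv_mul_cancel₀ hc, one_smul]

theorem inv_smul_sum_Icc_affine (hn : 1 ≤ n) (z G : ℕ → E) (x : E) (δ : ℝ) :
    (n : ℝ)⁻¹ • ∑ k ∈ Icc 1 n, (z k - x + δ • G k)
      = (n : ℝ)⁻¹ • ∑ k ∈ Icc 1 n, z k - x + δ • ((n : ℝ)⁻¹ • ∑ k ∈ Icc 1 n, G k) := by
  rw [sum_add_distrib, sum_sub_distrib, ← smul_sum, smul_add, smul_sub,
    inv_smul_sum_Icc_const hn, smul_comm δ]

end Average

section Substep

variable {α : Type*} {l : Filter α} {d : ℕ} {dt : α → ℝ} {v : α → EuclideanSpace ℝ (Fin d)}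

/-- Regularity of the coefficients of one semi-implicit substep with `n` input channels:
`S₁` and `S₀` are the implicit operator at the new and at the old time. -/
structure SubstepRegular (l : Filter α) (dt : α → ℝ) (n : ℕ)
    (B : ℕ → α → Matrix (Fin d) (Fin d) ℝ) (S₁ S₀ : α → Matrix (Fin d) (Fin d) ℝ)
    (f : α → EuclideanSpace ℝ (Fin d)) : Prop where
  explicit_bounded : ∀ s ∈ Icc 1 n,
    (fun p => Matrix.toEuclideanCLM (𝕜 := ℝ) (B s p)) =O[l] fun _ => (1 : ℝ)
  implicit_posDef : ∀ᶠ p in l, (S₁ p).PosDef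
  implicit_bounded : (fun p => Matrix.toEuclideanCLM (𝕜 := ℝ) (S₁ p)) =O[l] fun _ => (1 : ℝ)
  implicit_sub : (fun p => Matrix.toEuclideanCLM (𝕜 := ℝ) (S₁ p)
    - Matrix.toEuclideanCLM (𝕜 := ℝ) (S₀ p)) =O[l] dt
  source_bounded : f =O[l] fun _ => (1 : ℝ)

theorem SubstepRegular.expansion {n : ℕ} {B : ℕ → α → Matrix (Fin d) (Fin d) ℝ}
    {S₁ S₀ : α → Matrix (Fin d) (Fin d) ℝ} {f : α → EuclideanSpace ℝ (Fin d)}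
    (h : SubstepRegular l dt n B S₁ S₀ f)
    (hdt : dt =O[l] fun _ => (1 : ℝ)) (hdt0 : ∀ᶠ p in l, 0 ≤ dt p)
    {w : α → EuclideanSpace ℝ (Fin d) × (ℕ → EuclideanSpace ℝ (Fin d))}
    {H : α → EuclideanSpace ℝ (Fin d)} (hw : FirstOrderExpansion l dt v n w H)
    {a : ℝ} (ha : 0 ≤ a) {z : α → EuclideanSpace ℝ (Fin d)}
    (hz : ∀ p, z p = matApp ((1 + (a * dt p) • S₁ p)⁻¹)
      ((w p).1 - (a * dt p) • ((∑ s ∈ Icc 1 n, matApp (B s p) ((w p).2 s)) + f p))) :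
    (fun p => z p - v p + dt p • (H p
        + a • ((∑ s ∈ Icc 1 n, matApp (B s p) (v p)) + matApp (S₀ p) (v p) + f p)))
        =O[l] (fun p => dt p * (dt p * (1 + ‖v p‖))) ∧
      (fun p => z p - v p) =O[l] (fun p => dt p * (1 + ‖v p‖)) ∧
      (fun p => H p
        + a • ((∑ s ∈ Icc 1 n, matApp (B s p) (v p)) + matApp (S₀ p) (v p) + f p))
        =O[l] fun p => 1 + ‖v p‖ := by
  refine semiImplicit_expansion (w := fun p => (w p).1) (ws := fun s p => (w p).2 s)
    (B := fun s p => Matrix.toEuclideanCLM (𝕜 := ℝ) (B s p))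
    (S₁ := fun p => Matrix.toEuclideanCLM (𝕜 := ℝ) (S₁ p))
    (S₀ := fun p => Matrix.toEuclideanCLM (𝕜 := ℝ) (S₀ p))
    hdt hw.average hw.slope hw.channel h.explicit_bounded h.implicit_bounded h.implicit_sub
    h.source_bounded ?_ ?_
  · filter_upwards [h.implicit_posDef, hdt0] with p hp h0
    rw [hz p]
    exact matApp_resolvent_eq hp (mul_nonneg ha h0) _
  · filter_upwards [h.implicit_posDef, hdt0] with p hp h0
    rw [hz p]
    exact norm_matApp_resolvent_le hp (mul_nonneg ha h0) _

theorem levelSub_expansion (hdt : dt =O[l] fun _ => (1 : ℝ)) (hdt0 : ∀ᶠ p in l, 0 ≤ dt p)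
    {pow : ℝ} (hpow : 0 ≤ pow) {cj : ℕ → ℕ}
    {B : ℕ → ℕ → ℕ → α → Matrix (Fin d) (Fin d) ℝ}
    {S₁ S₀ : ℕ → ℕ → α → Matrix (Fin d) (Fin d) ℝ}
    {f : ℕ → ℕ → α → EuclideanSpace ℝ (Fin d)}
    {w : α → EuclideanSpace ℝ (Fin d) × (ℕ → EuclideanSpace ℝ (Fin d))}
    {H : α → EuclideanSpace ℝ (Fin d)} (hw : FirstOrderExpansion l dt v (cj 0) w H)
    (K : ℕ) (hcj : ∀ m ∈ Icc 1 K, 1 ≤ cj m)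
    (hreg : ∀ m ∈ Icc 1 K, ∀ k ∈ Icc 1 (cj m),
      SubstepRegular l dt (cj (m - 1)) (B m k) (S₁ m k) (S₀ m k) (f m k)) :
    FirstOrderExpansion l dt v (cj K)
      (fun p => levelSub d pow cj (fun m k s => B m k s p) (fun m k => S₁ m k p)
        (fun m k => f m k p) (dt p) (w p) K)
      (fun p => H p + pow • ∑ m ∈ Icc 1 K, ∑ k ∈ Icc 1 (cj m),
        ((∑ s ∈ Icc 1 (cj (m - 1)), matApp (B m k s p) (v p)) + matApp (S₀ m k p) (v p)
          + f m k p)) := by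
  induction K with
  | zero => simpa [levelSub] using hw
  | succ K ih =>
    have hsub : ∀ m ∈ Icc 1 K, m ∈ Icc 1 (K + 1) := fun m hm => by
      simp only [mem_Icc] at hm ⊢; omega
    have hK : K + 1 ∈ Icc 1 (K + 1) := by simp
    have ih := ih (fun m hm => hcj m (hsub m hm)) (fun m hm => hreg m (hsub m hm))
    have hc : (cj (K + 1) : ℝ) ≠ 0 := by
      have := hcj _ hK
      positivity
    have hstep := fun k (hk : k ∈ Icc 1 (cj (K + 1))) =>
      (hreg _ hK k hk).expansion hdt hdt0 ih (a := pow * cj (K + 1)) (by positivity)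
        (fun p => rfl)
    have hsplit : ∀ p, ((cj (K + 1) : ℝ))⁻¹ • ∑ k ∈ Icc 1 (cj (K + 1)),
        ((H p + pow • ∑ m ∈ Icc 1 K, ∑ k ∈ Icc 1 (cj m),
          ((∑ s ∈ Icc 1 (cj (m - 1)), matApp (B m k s p) (v p)) + matApp (S₀ m k p) (v p)
            + f m k p)) + (pow * cj (K + 1)) • ((∑ s ∈ Icc 1 (cj (K + 1 - 1)),
              matApp (B (K + 1) k s p) (v p)) + matApp (S₀ (K + 1) k p) (v p) + f (K + 1) k p))
        = H p + pow • ∑ m ∈ Icc 1 (K + 1), ∑ k ∈ Icc 1 (cj m),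
          ((∑ s ∈ Icc 1 (cj (m - 1)), matApp (B m k s p) (v p)) + matApp (S₀ m k p) (v p)
            + f m k p) := fun p => by
      rw [sum_add_distrib, smul_add, inv_smul_sum_Icc_const (hcj _ hK), ← smul_sum, smul_smul, sum_Icc_succ_top (by omega),
        smul_add, ← add_assoc, show (cj (K + 1) : ℝ)⁻¹ * (pow * cj (K + 1)) = pow by field_simp]
    refine ⟨?_, fun k hk => (hstep k hk).2.1, ?_⟩
    · have h := (IsBigO.fun_sum fun k hk => (hstep k hk).1).const_smul_left
        ((cj (K + 1) : ℝ))⁻¹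
      refine h.congr_left fun p => ?_
      rw [← hsplit p]
      exact inv_smul_sum_Icc_affine (hcj _ hK) _ _ _ _
    · have h := (IsBigO.fun_sum fun k hk => (hstep k hk).2.2).const_smul_left
        ((cj (K + 1) : ℝ))⁻¹
      exact h.congr_left hsplit

end Substep

section Branches

variable {α : Type*} {l : Filter α} {d : ℕ} {dt t t₁ : α → ℝ}
  {v : α → EuclideanSpace ℝ (Fin d)} {M : ℕ → ℕ} {c : ℕ → ℕ → ℕ}
  {A : ℕ → ℕ → ℕ → ℕ → ℝ → Matrix (Fin d) (Fin d) ℝ}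
  {S : ℕ → ℕ → ℕ → ℝ → Matrix (Fin d) (Fin d) ℝ}
  {f : ℕ → ℕ → ℕ → ℝ → EuclideanSpace ℝ (Fin d)}

/-- The contribution of grid level `j` to minus the right-hand side of the ODE. -/
noncomputable def levelRhs (M : ℕ → ℕ) (c : ℕ → ℕ → ℕ)
    (A : ℕ → ℕ → ℕ → ℕ → ℝ → Matrix (Fin d) (Fin d) ℝ)
    (S : ℕ → ℕ → ℕ → ℝ → Matrix (Fin d) (Fin d) ℝ)
    (f : ℕ → ℕ → ℕ → ℝ → EuclideanSpace ℝ (Fin d))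
    (j : ℕ) (τ : ℝ) (x : EuclideanSpace ℝ (Fin d)) : EuclideanSpace ℝ (Fin d) :=
  ∑ m ∈ Icc 1 (M j), ∑ k ∈ Icc 1 (c j m),
    ((∑ s ∈ Icc 1 (c j (m - 1)), matApp (A j m k s τ) x) + matApp (S j m k τ) x + f j m k τ)

/-- All channel counts of level `j` are positive and its substeps have regular coefficients. -/
structure LevelRegular (l : Filter α) (dt t t₁ : α → ℝ) (M : ℕ → ℕ) (c : ℕ → ℕ → ℕ)
    (A : ℕ → ℕ → ℕ → ℕ → ℝ → Matrix (Fin d) (Fin d) ℝ)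
    (S : ℕ → ℕ → ℕ → ℝ → Matrix (Fin d) (Fin d) ℝ)
    (f : ℕ → ℕ → ℕ → ℝ → EuclideanSpace ℝ (Fin d)) (j : ℕ) : Prop where
  one_le_substeps : 1 ≤ M j
  one_le_channels : ∀ m ∈ Icc 1 (M j), 1 ≤ c j m
  channels_zero : c j 0 = c (j - 1) (M (j - 1))
  substep : ∀ m ∈ Icc 1 (M j), ∀ k ∈ Icc 1 (c j m),
    SubstepRegular l dt (c j (m - 1)) (fun s p => A j m k s (t p)) (fun p => S j m k (t₁ p))
      (fun p => S j m k (t p)) (fun p => f j m k (t p))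

theorem LevelRegular.expansion {j : ℕ} (h : LevelRegular l dt t t₁ M c A S f j)
    (hdt : dt =O[l] fun _ => (1 : ℝ)) (hdt0 : ∀ᶠ p in l, 0 ≤ dt p) {pow : ℝ} (hpow : 0 ≤ pow)
    {w : α → EuclideanSpace ℝ (Fin d) × (ℕ → EuclideanSpace ℝ (Fin d))}
    {H : α → EuclideanSpace ℝ (Fin d)}
    (hw : FirstOrderExpansion l dt v (c (j - 1) (M (j - 1))) w H) :
    FirstOrderExpansion l dt v (c j (M j))
      (fun p => levelSub d pow (c j) (fun m k s => A j m k s (t p))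
        (fun m k => S j m k (t₁ p)) (fun m k => f j m k (t p)) (dt p) (w p) (M j))
      (fun p => H p + pow • levelRhs M c A S f j (t p) (v p)) := by
  rw [← h.channels_zero] at hw
  exact levelSub_expansion hdt hdt0 hpow hw (M j) h.one_le_channels h.substep

theorem levelSub_fst_eq_average {pow : ℝ} {cj : ℕ → ℕ}
    {Am : ℕ → ℕ → ℕ → Matrix (Fin d) (Fin d) ℝ} {Sm : ℕ → ℕ → Matrix (Fin d) (Fin d) ℝ}
    {fm : ℕ → ℕ → EuclideanSpace ℝ (Fin d)} {δ : ℝ}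
    {init : EuclideanSpace ℝ (Fin d) × (ℕ → EuclideanSpace ℝ (Fin d))} {K : ℕ} (hK : 1 ≤ K) :
    (levelSub d pow cj Am Sm fm δ init K).1
      = (cj K : ℝ)⁻¹ • ∑ k ∈ Icc 1 (cj K), (levelSub d pow cj Am Sm fm δ init K).2 k := by
  cases K with
  | zero => omega
  | succ K => rfl

theorem alg6Left_fst_eq_average {δ τ τ₁ : ℝ} {x : EuclideanSpace ℝ (Fin d)} {j : ℕ}
    (hj : 1 ≤ j) (hM : 1 ≤ M j) :
    (alg6Left d M c A S f δ τ τ₁ x j).1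
      = (c j (M j) : ℝ)⁻¹ • ∑ k ∈ Icc 1 (c j (M j)),
        (alg6Left d M c A S f δ τ τ₁ x j).2 k := by
  cases j with
  | zero => omega
  | succ j => exact levelSub_fst_eq_average hM

theorem alg6Left_expansion (hdt : dt =O[l] fun _ => (1 : ℝ)) (hdt0 : ∀ᶠ p in l, 0 ≤ dt p)
    (j : ℕ) (hreg : ∀ i ∈ Icc 1 j, LevelRegular l dt t t₁ M c A S f i) :
    FirstOrderExpansion l dt v (c j (M j))
      (fun p => alg6Left d M c A S f (dt p) (t p) (t₁ p) (v p) j)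
      (fun p => ∑ i ∈ Icc 1 j, (2 : ℝ) ^ (i - 1) • levelRhs M c A S f i (t p) (v p)) := by
  induction j with
  | zero =>
    refine ⟨?_, fun s _ => ?_, ?_⟩
    · simpa [alg6Left] using isBigO_zero _ _
    · simpa [alg6Left] using isBigO_zero _ _
    · simpa using isBigO_zero _ _
  | succ j ih =>
    have ih := ih fun i hi => hreg i (by simp only [mem_Icc] at hi ⊢; omega)
    have h := (hreg (j + 1) (by simp)).expansion hdt hdt0 (pow := 2 ^ j) (by positivity) ih
    simp only [sum_Icc_succ_top (Nat.le_add_left 1 j), Nat.add_sub_cancel]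
    exact h

/-- The relaxation halves the over-weighted sum and moves level `q + 2` to the equally weighted
block of levels. -/
theorem relaxation_weights {E : Type*} [AddCommGroup E] [Module ℝ E] (G : ℕ → E) (q i : ℕ) :
    (1 / 2 : ℝ) • ((∑ j ∈ Icc 1 (q + 2), (2 : ℝ) ^ (j - 1) • G j
          + (2 : ℝ) ^ (q + 1) • ∑ j ∈ Icc (q + 3) (q + 2 * i + 2), G j)
          + (2 : ℝ) ^ (q + 1) • G (q + 2 * i + 3))
        + (1 / 2 : ℝ) • ∑ j ∈ Icc 1 (q + 1), (2 : ℝ) ^ (j - 1) • G j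
      = ∑ j ∈ Icc 1 (q + 1), (2 : ℝ) ^ (j - 1) • G j
        + (2 : ℝ) ^ q • ∑ j ∈ Icc (q + 2) (q + 2 * i + 3), G j := by
  rw [sum_Icc_succ_top (show 1 ≤ q + 1 + 1 by omega),
    sum_Icc_succ_top (show q + 2 ≤ q + 2 * i + 2 + 1 by omega),
    ← add_sum_Ioc_eq_sum_Icc (show q + 2 ≤ q + 2 * i + 2 by omega),
    show Ioc (q + 2) (q + 2 * i + 2) = Icc (q + 3) (q + 2 * i + 2) by
      ext; simp only [mem_Ioc, mem_Icc]; omega,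
    show q + 1 + 1 - 1 = q + 1 by omega, pow_succ]
  module

theorem FirstOrderExpansion.relax {N : ℕ}
    {w₁ w₂ w : α → EuclideanSpace ℝ (Fin d) × (ℕ → EuclideanSpace ℝ (Fin d))}
    {H₁ H₂ : α → EuclideanSpace ℝ (Fin d)}
    (h₁ : FirstOrderExpansion l dt v N w₁ H₁) (h₂ : FirstOrderExpansion l dt v N w₂ H₂)
    (hw₁ : ∀ p, (w₁ p).1 = (N : ℝ)⁻¹ • ∑ k ∈ Icc 1 N, (w₁ p).2 k)
    (hw₂ : ∀ p, (w₂ p).1 = (N : ℝ)⁻¹ • ∑ k ∈ Icc 1 N, (w₂ p).2 k)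
    (hw : ∀ p, (w p).1 = (N : ℝ)⁻¹ • ∑ k ∈ Icc 1 N, (w p).2 k)
    (hwk : ∀ p k, (w p).2 k = (1 / 2 : ℝ) • (w₁ p).2 k + (1 / 2 : ℝ) • (w₂ p).2 k) :
    FirstOrderExpansion l dt v N w
      (fun p => (1 / 2 : ℝ) • H₁ p + (1 / 2 : ℝ) • H₂ p) := by
  have havg : ∀ p, (w p).1 = (1 / 2 : ℝ) • (w₁ p).1 + (1 / 2 : ℝ) • (w₂ p).1 := fun p => by
    rw [hw, hw₁, hw₂]
    simp only [hwk, sum_add_distrib, ← smul_sum]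
    module
  refine ⟨?_, fun k hk => ?_,
    (h₁.slope.const_smul_left (1 / 2 : ℝ)).add (h₂.slope.const_smul_left (1 / 2 : ℝ))⟩
  · refine ((h₁.average.const_smul_left (1 / 2 : ℝ)).add
      (h₂.average.const_smul_left (1 / 2 : ℝ))).congr_left fun p => ?_
    simp only [havg, Pi.smul_apply]
    module
  · refine (((h₁.channel k hk).const_smul_left (1 / 2 : ℝ)).add
      ((h₂.channel k hk).const_smul_left (1 / 2 : ℝ))).congr_left fun p => ?_
    simp only [hwk, Pi.smul_apply]
    module

theorem alg6Right_expansion (hdt : dt =O[l] fun _ => (1 : ℝ)) (hdt0 : ∀ᶠ p in l, 0 ≤ dt p)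
    {J : ℕ} (hreg : ∀ i ∈ Icc 1 (2 * J - 1), LevelRegular l dt t t₁ M c A S f i)
    (hcompat : ∀ j, J < j → j ≤ 2 * J - 1 → c j (M j) = c (2 * J - j) (M (2 * J - j)))
    (i : ℕ) (hi : i + 1 ≤ J) :
    FirstOrderExpansion l dt v (c (J + i) (M (J + i)))
      (fun p => alg6Right d J M c A S f (dt p) (t p) (t₁ p) (v p) i)
      (fun p => ∑ j ∈ Icc 1 (J - i), (2 : ℝ) ^ (j - 1) • levelRhs M c A S f j (t p) (v p)
        + (2 : ℝ) ^ (J - i - 1) • ∑ j ∈ Icc (J - i + 1) (J + i),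
          levelRhs M c A S f j (t p) (v p)) := by
  induction i with
  | zero =>
    simpa [alg6Right] using alg6Left_expansion (v := v) hdt hdt0 J
      fun i hi => hreg i (by simp only [mem_Icc] at hi ⊢; omega)
  | succ i ih =>
    obtain ⟨q, rfl⟩ : ∃ q, J = q + i + 2 := ⟨J - i - 2, by omega⟩
    have ih := ih (by omega)
    have hj := hreg (q + i + 2 + i + 1) (by simp only [mem_Icc]; omega)
    have hs := hj.expansion hdt hdt0
      (pow := 2 ^ (2 * (q + i + 2) - (q + i + 2 + i + 1))) (by positivity) ih
    have hl := alg6Left_expansion (v := v) hdt hdt0 (q + 1)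
      fun i hi => hreg i (by simp only [mem_Icc] at hi ⊢; omega)
    have hq : 2 * (q + i + 2) - (q + i + 2 + i + 1) = q + 1 := by omega
    have hcc := hcompat (q + i + 2 + i + 1) (by omega) (by omega)
    rw [hq] at hcc
    rw [hq, hcc] at hs
    have hr := hs.relax hl
      (w := fun p => alg6Right d (q + i + 2) M c A S f (dt p) (t p) (t₁ p) (v p) (i + 1))
      (fun p => by rw [← hcc]; exact levelSub_fst_eq_average hj.one_le_substeps)
      (fun p => alg6Left_fst_eq_average (by omega)
        (hreg (q + 1) (by simp only [mem_Icc]; omega)).one_le_substeps)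
      (fun p => by simp only [alg6Right, hq, hcc])
      (fun p k => by simp only [alg6Right, hq])
    rw [show q + i + 2 + (i + 1) = q + i + 2 + i + 1 by omega, hcc,
      show q + i + 2 - (i + 1) = q + 1 by omega, show q + 1 - 1 = q by omega,
      show q + i + 2 + i + 1 = q + 2 * i + 3 by omega]
    rw [show q + i + 2 + i + 1 = q + 2 * i + 3 by omega,
      show q + i + 2 - i = q + 2 by omega, show q + 2 - 1 = q + 1 by omega,
      show q + i + 2 + i = q + 2 * i + 2 by omega] at hr
    simpa only [relaxation_weights] using hr

end Branches

section Step

variable {α : Type*} {l : Filter α} {d : ℕ} {dt t t₁ : α → ℝ}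
  {v : α → EuclideanSpace ℝ (Fin d)} {M : ℕ → ℕ} {c : ℕ → ℕ → ℕ}
  {A : ℕ → ℕ → ℕ → ℕ → ℝ → Matrix (Fin d) (Fin d) ℝ}
  {S : ℕ → ℕ → ℕ → ℝ → Matrix (Fin d) (Fin d) ℝ}
  {f : ℕ → ℕ → ℕ → ℝ → EuclideanSpace ℝ (Fin d)}
  {Astar : ℕ → ℝ → Matrix (Fin d) (Fin d) ℝ} {Sstar : ℝ → Matrix (Fin d) (Fin d) ℝ}
  {fstar : ℝ → EuclideanSpace ℝ (Fin d)}

/-- Consistency: one step of the scheme agrees with an explicit Euler step up to `O(Δt²)`. -/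
theorem alg6Step_expansion (hdt : dt =O[l] fun _ => (1 : ℝ)) (hdt0 : ∀ᶠ p in l, 0 ≤ dt p)
    {J : ℕ} (hJ : 1 ≤ J)
    (hreg : ∀ i ∈ Icc 1 (2 * J - 1), LevelRegular l dt t t₁ M c A S f i)
    (hcompat : ∀ j, J < j → j ≤ 2 * J - 1 → c j (M j) = c (2 * J - j) (M (2 * J - j)))
    (hstar : SubstepRegular l dt (c (2 * J - 1) (M (2 * J - 1))) (fun s p => Astar s (t p))
      (fun p => Sstar (t₁ p)) (fun p => Sstar (t p)) (fun p => fstar (t p))) :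
    (fun p => alg6Step d J M c A S f Astar Sstar fstar (dt p) (t p) (t₁ p) (v p) - v p
      + dt p • (∑ j ∈ Icc 1 (2 * J - 1), levelRhs M c A S f j (t p) (v p)
        + ((∑ s ∈ Icc 1 (c (2 * J - 1) (M (2 * J - 1))), matApp (Astar s (t p)) (v p))
          + matApp (Sstar (t p)) (v p) + fstar (t p))))
      =O[l] fun p => dt p * (dt p * (1 + ‖v p‖)) := by
  have hr := alg6Right_expansion (v := v) hdt hdt0 hreg hcompat (J - 1) (by omega)
  rw [show J + (J - 1) = 2 * J - 1 by omega, show J - (J - 1) = 1 by omega] at hr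
  have h := (hstar.expansion hdt hdt0 hr zero_le_one (fun p => rfl)).1
  refine h.congr_left fun p => ?_
  rw [← add_sum_Ioc_eq_sum_Icc (show 1 ≤ 2 * J - 1 by omega),
    show Ioc 1 (2 * J - 1) = Icc (1 + 1) (2 * J - 1) by
      ext; simp only [mem_Ioc, mem_Icc]; omega]
  simp [alg6Step]

end Step

section Convergence

variable {E : Type*} [NormedAddCommGroup E]

theorem LipschitzOnWith.exists_finset_sum {X ι : Type*} [PseudoEMetricSpace X] {σ : Set X}
    {g : ι → X → E} (s : Finset ι) (h : ∀ i ∈ s, ∃ K, LipschitzOnWith K (g i) σ) :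
    ∃ K, LipschitzOnWith K (fun x => ∑ i ∈ s, g i x) σ := by
  classical
  induction s using Finset.induction_on with
  | empty => exact ⟨0, by simp⟩
  | insert i s hi ih =>
    obtain ⟨K₁, h₁⟩ := h i (mem_insert_self i s)
    obtain ⟨K₂, h₂⟩ := ih fun j hj => h j (mem_insert_of_mem hj)
    exact ⟨K₁ + K₂, by simpa only [sum_insert hi] using h₁.add h₂⟩

theorem LipschitzOnWith.exists_bound_Icc {g : ℝ → E} {K : NNReal} {T : ℝ}
    (h : LipschitzOnWith K g (Set.Icc 0 T)) : ∃ C, 0 ≤ C ∧ ∀ t ∈ Set.Icc 0 T, ‖g t‖ ≤ C := by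
  obtain ⟨C, hC⟩ := isCompact_Icc.exists_bound_of_continuousOn h.continuousOn
  exact ⟨max C 0, le_max_right _ _, fun t ht => (hC t ht).trans (le_max_left _ _)⟩

variable [NormedSpace ℝ E]

/-- A one-step estimate for the error accumulates to a first-order global bound. -/
theorem error_accumulation {a b h : ℝ} {N : ℕ} {e : ℕ → ℝ} (ha : 0 ≤ a) (hb : 0 ≤ b)
    (hh : 0 ≤ h) (h0 : e 0 = 0)
    (hstep : ∀ n < N, e (n + 1) ≤ (1 + h * a) * e n + h * (h * b)) (n : ℕ) (hn : n ≤ N) :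
    e n ≤ n * (h * (h * b)) * Real.exp (n * (h * a)) := by
  induction n with
  | zero => simp [h0]
  | succ n ih =>
    have ih := ih (by omega)
    set q := h * (h * b) with hq
    have hq0 : 0 ≤ q := by positivity
    have hexp : Real.exp ((n + 1 : ℕ) * (h * a)) = Real.exp (n * (h * a)) * Real.exp (h * a) := by
      rw [← Real.exp_add]; push_cast; ring_nf
    have h1 : 1 + h * a ≤ Real.exp (h * a) := by
      linarith [Real.add_one_le_exp (h * a)]
    have h2 : 1 ≤ Real.exp ((n + 1 : ℕ) * (h * a)) := Real.one_le_exp (by positivity)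
    calc e (n + 1) ≤ (1 + h * a) * e n + q := hstep n (by omega)
      _ ≤ (1 + h * a) * (n * q * Real.exp (n * (h * a))) + q := by gcongr
      _ ≤ Real.exp (h * a) * (n * q * Real.exp (n * (h * a)))
          + q * Real.exp ((n + 1 : ℕ) * (h * a)) := by
        gcongr
        exact le_mul_of_one_le_right hq0 h2
      _ = _ := by rw [hexp]; push_cast; ring

/-- A one-step method that agrees with the explicit Euler method up to `O(Δt²)` converges with
first order for a linear ODE with Lipschitz coefficients. -/
theorem oneStep_first_order {T : ℝ} (hT : 0 < T) {P : ℝ → E →L[ℝ] E} {φ : ℝ → E}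
    {KP Kφ : NNReal} (hP : LipschitzOnWith KP P (Set.Icc 0 T))
    (hφ : LipschitzOnWith Kφ φ (Set.Icc 0 T)) {u : ℝ → E}
    (hu : ∀ t ∈ Set.Icc 0 T, HasDerivAt u (-(P t (u t) + φ t)) t)
    {Φ : ℝ → ℝ → ℝ → E → E} {K : ℝ}
    (hΦ : ∀ δ t x, 0 < δ → 0 ≤ t → t + δ ≤ T →
      ‖Φ δ t (t + δ) x - x + δ • (P t x + φ t)‖ ≤ K * (δ * (δ * (1 + ‖x‖))))
    {uN : ℕ → ℕ → E} (huN0 : ∀ N, uN N 0 = u 0)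
    (huN : ∀ N n : ℕ,
      uN N (n + 1) = Φ (T / N) (n * (T / N)) ((n + 1) * (T / N)) (uN N n)) :
    ∃ C > (0 : ℝ), ∃ N₀ : ℕ, ∀ N ≥ N₀, ∀ n ≤ N,
      ‖uN N n - u (n * (T / N))‖ ≤ C * (T / N) := by
  wlog hK : 0 ≤ K generalizing K
  · exact this (K := max K 0) (fun δ t x h1 h2 h3 => (hΦ δ t x h1 h2 h3).trans
      (by gcongr; exact le_max_left _ _)) (le_max_right _ _)
  obtain ⟨CP, hCP0, hCP⟩ := hP.exists_bound_Icc
  obtain ⟨Cφ, hCφ0, hCφ⟩ := hφ.exists_bound_Icc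
  obtain ⟨U, hU'⟩ := isCompact_Icc.exists_bound_of_continuousOn
    (f := u) (s := Set.Icc 0 T) fun t ht => (hu t ht).continuousAt.continuousWithinAt
  have hU0 : 0 ≤ U := (norm_nonneg _).trans (hU' 0 ⟨le_rfl, hT.le⟩)
  have hLip : ∀ s ∈ Set.Icc 0 T, ∀ t ∈ Set.Icc 0 T, ‖u t - u s‖ ≤ (CP * U + Cφ) * |t - s| :=
    fun s hs t ht => (convex_Icc 0 T).norm_image_sub_le_of_norm_hasDerivWithin_le
      (fun x hx => (hu x hx).hasDerivWithinAt) (fun x hx => by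
        rw [norm_neg]
        refine (norm_add_le _ _).trans (add_le_add ?_ (hCφ x hx))
        exact ((P x).le_opNorm _).trans
          (mul_le_mul (hCP x hx) (hU' x hx) (norm_nonneg _) hCP0)) hs ht
  set D : ℝ := KP * U + CP * (CP * U + Cφ) + Kφ with hD
  have hD0 : 0 ≤ D := by positivity
  have hF : ∀ s ∈ Set.Icc 0 T, ∀ t ∈ Set.Icc 0 T,
      ‖(P t (u t) + φ t) - (P s (u s) + φ s)‖ ≤ D * |t - s| := fun s hs t ht => by
    have h1 : ‖(P t - P s) (u t)‖ ≤ KP * |t - s| * U :=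
      ((P t - P s).le_opNorm _).trans (mul_le_mul (hP.norm_sub_le ht hs) (hU' t ht)
        (norm_nonneg _) (by positivity))
    have h2 : ‖P s (u t - u s)‖ ≤ CP * ((CP * U + Cφ) * |t - s|) :=
      ((P s).le_opNorm _).trans (mul_le_mul (hCP s hs) (hLip s hs t ht) (norm_nonneg _) hCP0)
    have h3 : ‖φ t - φ s‖ ≤ Kφ * |t - s| := hφ.norm_sub_le ht hs
    have heq : (P t (u t) + φ t) - (P s (u s) + φ s)
        = (P t - P s) (u t) + P s (u t - u s) + (φ t - φ s) := by
      rw [sub_apply, map_sub]; abel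
    rw [heq]
    refine (norm_add₃_le).trans ?_
    rw [hD]
    linarith
  have hlocal : ∀ t δ, 0 ≤ t → 0 ≤ δ → t + δ ≤ T →
      ‖u (t + δ) - u t + δ • (P t (u t) + φ t)‖ ≤ D * δ * δ := fun t δ ht hδ htδ => by
    have hsub : ∀ s ∈ Set.Icc t (t + δ), s ∈ Set.Icc 0 T := fun s hs =>
      ⟨ht.trans hs.1, hs.2.trans htδ⟩
    have htT := hsub t ⟨le_rfl, by linarith⟩
    have h := (convex_Icc t (t + δ)).norm_image_sub_le_of_norm_hasDerivWithin_le
      (f := fun s => u s + (s - t) • (P t (u t) + φ t))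
      (f' := fun s => -(P s (u s) + φ s) + (1 : ℝ) • (P t (u t) + φ t)) (C := D * δ)
      (fun s hs => ((hu s (hsub s hs)).add
        (((hasDerivAt_id s).sub_const t).smul_const _)).hasDerivWithinAt)
      (fun s hs => by
        rw [one_smul, neg_add_eq_sub, norm_sub_rev]
        refine (hF t htT s (hsub s hs)).trans ?_
        gcongr
        rw [abs_of_nonneg (by linarith [hs.1])]
        linarith [hs.2])
      (show t ∈ Set.Icc t (t + δ) from ⟨le_rfl, by linarith⟩)
      (show t + δ ∈ Set.Icc t (t + δ) from ⟨by linarith, le_rfl⟩)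
    simp only [sub_self, zero_smul, add_zero, add_sub_cancel_left, Real.norm_of_nonneg hδ] at h
    convert h using 2
    abel
  set a : ℝ := K * T + CP with ha
  set b : ℝ := K * (1 + U) + D with hb
  have ha0 : 0 ≤ a := by positivity
  have hb0 : 0 ≤ b := by positivity
  refine ⟨T * b * Real.exp (T * a) + 1, by positivity, 1, fun N hN n hn => ?_⟩
  have hN0 : (0 : ℝ) < N := by exact_mod_cast hN
  set h := T / N with hh
  have hh0 : 0 < h := by positivity
  have hNh : N * h = T := by rw [hh]; field_simp
  have hhT : h ≤ T := by
    have : (1 : ℝ) ≤ N := by exact_mod_cast hN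
    nlinarith
  have hnh : ∀ m ≤ N, (m : ℝ) * h ≤ T := fun m hm => by
    rw [← hNh]; gcongr
  have hrec : ∀ m < N, ‖uN N (m + 1) - u ((m + 1 : ℕ) * h)‖
      ≤ (1 + h * a) * ‖uN N m - u (m * h)‖ + h * (h * b) := fun m hm => by
    have hm1 : ((m : ℝ) + 1) * h = m * h + h := by ring
    have hmT : (m : ℝ) * h + h ≤ T := by
      have := hnh (m + 1) hm
      push_cast at this
      linarith
    have hm0 : 0 ≤ (m : ℝ) * h := by positivity
    have hmem : (m : ℝ) * h ∈ Set.Icc 0 T := ⟨hm0, by linarith⟩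
    push_cast
    rw [huN, hm1]
    set x := uN N m
    set τ := (m : ℝ) * h
    have h1 := hΦ h τ x hh0 hm0 hmT
    have h2 := hlocal τ h hm0 hh0.le hmT
    have h3 : ‖h • P τ (x - u τ)‖ ≤ h * (CP * ‖x - u τ‖) := by
      rw [norm_smul, Real.norm_of_nonneg hh0.le]
      gcongr
      exact (P τ).le_of_opNorm_le (hCP τ hmem) _
    have hx : ‖x‖ ≤ ‖x - u τ‖ + U := by
      have := norm_add_le (x - u τ) (u τ)
      rw [sub_add_cancel] at this
      linarith [hU' τ hmem]
    have heq : Φ h τ (τ + h) x - u (τ + h)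
        = (Φ h τ (τ + h) x - x + h • (P τ x + φ τ))
          - (u (τ + h) - u τ + h • (P τ (u τ) + φ τ)) + (x - u τ) - h • P τ (x - u τ) := by
      rw [map_sub]; module
    have h4 : K * (h * (h * (1 + ‖x‖))) ≤ K * (h * (h * (1 + U))) + K * (h * (T * ‖x - u τ‖)) := by
      have : h * (1 + ‖x‖) ≤ h * (1 + U) + T * ‖x - u τ‖ := by
        nlinarith [norm_nonneg (x - u τ)]
      calc K * (h * (h * (1 + ‖x‖))) ≤ K * (h * (h * (1 + U) + T * ‖x - u τ‖)) := by gcongr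
        _ = _ := by ring
    rw [heq]
    refine (norm_sub_le _ _).trans ?_
    refine (add_le_add ((norm_add_le _ _).trans
      (add_le_add ((norm_sub_le _ _).trans (add_le_add h1 h2)) le_rfl)) h3).trans ?_
    rw [ha, hb]
    nlinarith
  have key := error_accumulation (e := fun m => ‖uN N m - u (m * h)‖) ha0 hb0 hh0.le
    (by simp [huN0]) hrec n hn
  refine key.trans ?_
  calc (n : ℝ) * (h * (h * b)) * Real.exp (n * (h * a))
      = (n * h) * b * Real.exp (n * h * a) * h := by ring_nf
    _ ≤ T * b * Real.exp (T * a) * h := by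
      have := hnh n hn
      gcongr
    _ ≤ (T * b * Real.exp (T * a) + 1) * h := by gcongr; linarith

end Convergence

section StepRegion

variable {d : ℕ} {T : ℝ}

/-- The admissible triples (step size, old time, old value) of one step on `[0, T]`. -/
def stepRegion (d : ℕ) (T : ℝ) : Set (ℝ × ℝ × EuclideanSpace ℝ (Fin d)) :=
  {p | 0 < p.1 ∧ 0 ≤ p.2.1 ∧ p.2.1 + p.1 ≤ T}

theorem stepRegion_old_mem {p : ℝ × ℝ × EuclideanSpace ℝ (Fin d)} (hp : p ∈ stepRegion d T) :
    p.2.1 ∈ Set.Icc 0 T :=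
  ⟨hp.2.1, by linarith [hp.1, hp.2.2]⟩

theorem stepRegion_new_mem {p : ℝ × ℝ × EuclideanSpace ℝ (Fin d)} (hp : p ∈ stepRegion d T) :
    p.2.1 + p.1 ∈ Set.Icc 0 T :=
  ⟨by linarith [hp.1, hp.2.1], hp.2.2⟩

theorem LipschitzOnWith.isBigO_comp_stepRegion {E : Type*} [NormedAddCommGroup E] {g : ℝ → E}
    {K : NNReal} (hg : LipschitzOnWith K g (Set.Icc 0 T))
    {τ : ℝ × ℝ × EuclideanSpace ℝ (Fin d) → ℝ}
    (hτ : ∀ p ∈ stepRegion d T, τ p ∈ Set.Icc 0 T) :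
    (fun p => g (τ p)) =O[𝓟 (stepRegion d T)] fun _ => (1 : ℝ) := by
  obtain ⟨C, -, hC⟩ := hg.exists_bound_Icc
  exact isBigO_principal.2 ⟨C, fun p hp => by simpa using hC _ (hτ p hp)⟩

theorem substepRegular_stepRegion {n : ℕ} {B : ℕ → ℝ → Matrix (Fin d) (Fin d) ℝ}
    {S : ℝ → Matrix (Fin d) (Fin d) ℝ} {f : ℝ → EuclideanSpace ℝ (Fin d)} {L : NNReal}
    (hB : ∀ s ∈ Icc 1 n,
      LipschitzOnWith L (fun t => Matrix.toEuclideanCLM (𝕜 := ℝ) (B s t)) (Set.Icc 0 T))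
    (hS : LipschitzOnWith L (fun t => Matrix.toEuclideanCLM (𝕜 := ℝ) (S t)) (Set.Icc 0 T))
    (hSpd : ∀ t ∈ Set.Icc (0 : ℝ) T, (S t).PosDef)
    (hf : LipschitzOnWith L f (Set.Icc 0 T)) :
    SubstepRegular (𝓟 (stepRegion d T)) (fun p => p.1) n (fun s p => B s p.2.1)
      (fun p => S (p.2.1 + p.1)) (fun p => S p.2.1) (fun p => f p.2.1) where
  explicit_bounded s hs := (hB s hs).isBigO_comp_stepRegion fun _ => stepRegion_old_mem
  implicit_posDef := eventually_principal.2 fun _ hp => hSpd _ (stepRegion_new_mem hp)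
  implicit_bounded := hS.isBigO_comp_stepRegion fun _ => stepRegion_new_mem
  implicit_sub := isBigO_principal.2 ⟨L, fun p hp => by
    simpa using hS.norm_sub_le (stepRegion_new_mem hp) (stepRegion_old_mem hp)⟩
  source_bounded := hf.isBigO_comp_stepRegion fun _ => stepRegion_old_mem

end StepRegion

/-- **First-order accuracy of the general hybrid splitting scheme with relaxation
(Theorem `thm.full`, Algorithm 6).** -/
theorem general_hybrid_splitting_first_order_accurate
    (d J : ℕ) (hd : 1 ≤ d) (hJ : 1 ≤ J) (T : ℝ) (hT : 0 < T)
    (M : ℕ → ℕ) (hM : ∀ j ∈ Finset.Icc 1 (2 * J - 1), 1 ≤ M j)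
    (c : ℕ → ℕ → ℕ)
    (hc_pos : ∀ j ∈ Finset.Icc 1 (2 * J - 1), ∀ m ∈ Finset.Icc 1 (M j), 1 ≤ c j m)
    (hc00 : c 0 (M 0) = 1)
    (hc0 : ∀ j ∈ Finset.Icc 1 (2 * J - 1), c j 0 = c (j - 1) (M (j - 1)))
    (hc_compat : ∀ j, J < j → j ≤ 2 * J - 1 → c j (M j) = c (2 * J - j) (M (2 * J - j)))
    (A : ℕ → ℕ → ℕ → ℕ → ℝ → Matrix (Fin d) (Fin d) ℝ)
    (S : ℕ → ℕ → ℕ → ℝ → Matrix (Fin d) (Fin d) ℝ)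
    (f : ℕ → ℕ → ℕ → ℝ → EuclideanSpace ℝ (Fin d))
    (Astar : ℕ → ℝ → Matrix (Fin d) (Fin d) ℝ)
    (Sstar : ℝ → Matrix (Fin d) (Fin d) ℝ)
    (fstar : ℝ → EuclideanSpace ℝ (Fin d))
    (L : NNReal)
    (hA_lip : ∀ j ∈ Finset.Icc 1 (2 * J - 1), ∀ m ∈ Finset.Icc 1 (M j),
      ∀ k ∈ Finset.Icc 1 (c j m), ∀ s ∈ Finset.Icc 1 (c j (m - 1)),
      LipschitzOnWith L (fun t => Matrix.toEuclideanCLM (𝕜 := ℝ) (A j m k s t)) (Set.Icc 0 T))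
    (hA_pd : ∀ j ∈ Finset.Icc 1 (2 * J - 1), ∀ m ∈ Finset.Icc 1 (M j),
      ∀ k ∈ Finset.Icc 1 (c j m), ∀ s ∈ Finset.Icc 1 (c j (m - 1)),
      ∀ t ∈ Set.Icc (0 : ℝ) T, (A j m k s t).PosDef)
    (hS_lip : ∀ j ∈ Finset.Icc 1 (2 * J - 1), ∀ m ∈ Finset.Icc 1 (M j),
      ∀ k ∈ Finset.Icc 1 (c j m),
      LipschitzOnWith L (fun t => Matrix.toEuclideanCLM (𝕜 := ℝ) (S j m k t)) (Set.Icc 0 T))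
    (hS_pd : ∀ j ∈ Finset.Icc 1 (2 * J - 1), ∀ m ∈ Finset.Icc 1 (M j),
      ∀ k ∈ Finset.Icc 1 (c j m), ∀ t ∈ Set.Icc (0 : ℝ) T, (S j m k t).PosDef)
    (hf_lip : ∀ j ∈ Finset.Icc 1 (2 * J - 1), ∀ m ∈ Finset.Icc 1 (M j),
      ∀ k ∈ Finset.Icc 1 (c j m), LipschitzOnWith L (f j m k) (Set.Icc 0 T))
    (hAstar_lip : ∀ s ∈ Finset.Icc 1 (c (2 * J - 1) (M (2 * J - 1))),
      LipschitzOnWith L (fun t => Matrix.toEuclideanCLM (𝕜 := ℝ) (Astar s t)) (Set.Icc 0 T))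
    (hAstar_pd : ∀ s ∈ Finset.Icc 1 (c (2 * J - 1) (M (2 * J - 1))),
      ∀ t ∈ Set.Icc (0 : ℝ) T, (Astar s t).PosDef)
    (hSstar_lip :
      LipschitzOnWith L (fun t => Matrix.toEuclideanCLM (𝕜 := ℝ) (Sstar t)) (Set.Icc 0 T))
    (hSstar_pd : ∀ t ∈ Set.Icc (0 : ℝ) T, (Sstar t).PosDef)
    (hfstar_lip : LipschitzOnWith L fstar (Set.Icc 0 T))
    (u0 : EuclideanSpace ℝ (Fin d)) (u : ℝ → EuclideanSpace ℝ (Fin d))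
    (hu0 : u 0 = u0)
    (hu : ∀ t ∈ Set.Icc (0 : ℝ) T, HasDerivAt u
      (-((∑ j ∈ Finset.Icc 1 (2 * J - 1), ∑ m ∈ Finset.Icc 1 (M j),
            ∑ k ∈ Finset.Icc 1 (c j m),
            ((∑ s ∈ Finset.Icc 1 (c j (m - 1)), matApp (A j m k s t) (u t))
              + matApp (S j m k t) (u t) + f j m k t))
        + ((∑ s ∈ Finset.Icc 1 (c (2 * J - 1) (M (2 * J - 1))), matApp (Astar s t) (u t))
            + matApp (Sstar t) (u t) + fstar t))) t)
    (uN : ℕ → ℕ → EuclideanSpace ℝ (Fin d))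
    (huN0 : ∀ N, uN N 0 = u0)
    (huNstep : ∀ N n : ℕ, uN N (n + 1) =
      alg6Step d J M c A S f Astar Sstar fstar
        (T / N) (n * (T / N)) ((n + 1) * (T / N)) (uN N n)) :
    ∃ C > (0 : ℝ), ∃ N₀ : ℕ, ∀ N ≥ N₀, ∀ n ≤ N,
      ‖uN N n - u (n * (T / N))‖ ≤ C * (T / N) := by
  have hstar := substepRegular_stepRegion hAstar_lip hSstar_lip hSstar_pd hfstar_lip
  have hreg : ∀ j ∈ Icc 1 (2 * J - 1), LevelRegular (𝓟 (stepRegion d T)) (fun p => p.1)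
      (fun p => p.2.1) (fun p => p.2.1 + p.1) M c A S f j := fun j hj =>
    ⟨hM j hj, hc_pos j hj, hc0 j hj, fun m hm k hk =>
      substepRegular_stepRegion (hA_lip j hj m hm k hk) (hS_lip j hj m hm k hk)
        (hS_pd j hj m hm k hk) (hf_lip j hj m hm k hk)⟩
  have hdt : (fun p : ℝ × ℝ × EuclideanSpace ℝ (Fin d) => p.1) =O[𝓟 (stepRegion d T)]
      fun _ => (1 : ℝ) := isBigO_principal.2 ⟨T, fun p hp => by
    rw [Real.norm_of_nonneg hp.1.le, norm_one, mul_one]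
    linarith [hp.2.1, hp.2.2]⟩
  obtain ⟨K, hK⟩ := isBigO_principal.1 (alg6Step_expansion (v := fun p => p.2.2) hdt
    (eventually_principal.2 fun p hp => hp.1.le) hJ hreg hc_compat hstar)
  obtain ⟨KP, hKP⟩ := LipschitzOnWith.exists_finset_sum (Icc 1 (2 * J - 1)) fun j hj =>
    LipschitzOnWith.exists_finset_sum (Icc 1 (M j)) fun m hm =>
      LipschitzOnWith.exists_finset_sum (Icc 1 (c j m)) fun k hk => by
        obtain ⟨K', hK'⟩ := LipschitzOnWith.exists_finset_sum (Icc 1 (c j (m - 1)))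
          fun s hs => ⟨L, hA_lip j hj m hm k hk s hs⟩
        exact ⟨_, hK'.add (hS_lip j hj m hm k hk)⟩
  obtain ⟨KP', hKP'⟩ := LipschitzOnWith.exists_finset_sum _ fun s hs => ⟨L, hAstar_lip s hs⟩
  obtain ⟨Kφ, hKφ⟩ := LipschitzOnWith.exists_finset_sum (Icc 1 (2 * J - 1)) fun j hj =>
    LipschitzOnWith.exists_finset_sum (Icc 1 (M j)) fun m hm =>
      LipschitzOnWith.exists_finset_sum (Icc 1 (c j m)) fun k hk =>
        ⟨L, hf_lip j hj m hm k hk⟩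
  refine oneStep_first_order hT (hKP.add (hKP'.add hSstar_lip)) (hKφ.add hfstar_lip)
    (K := K) ?_ ?_ (fun N => (huN0 N).trans hu0.symm) huNstep
  · intro t ht
    refine (hu t ht).congr_deriv (congrArg Neg.neg ?_)
    simp only [matApp, add_apply, _root_.sum_apply, sum_add_distrib]
    abel
  · intro δ t x hδ ht htδ
    have h := hK (δ, t, x) ⟨hδ, ht, htδ⟩
    rw [Real.norm_of_nonneg (r := δ * (δ * (1 + ‖x‖))) (by positivity)] at h
    refine le_of_eq_of_le (congrArg norm (congrArg₂ (· + ·) rfl (congrArg (δ • ·) ?_))) h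
    simp only [levelRhs, matApp, add_apply, _root_.sum_apply, sum_add_distrib]
    abel
end

section
/- Let Ω ⊂ ℝ² have finite positive Lebesgue measure, K ≥ 2, f_1,…,f_K : Ω → ℝ nonnegative integrable, λ > 0, σ > 0. For ε ≥ 0 define F_ε(v) = Σ_{k=1}^K [ ∫_Ω v_k f_k dx + ε ∫_Ω v_k ln v_k dx + (λ/2) ∫_Ω v_k(x) (G_σ * (1_Ω − v_k))(x) dx ] on S = { v = (v_1,…,v_K) : v_k measurable, v_k ≥ 0 a.e., Σ_k v_k = 1 a.e. } (convention 0·ln 0 = 0, each v_k extended by zero outside Ω). If ε_n → 0, v^{(n)} ∈ S, v ∈ S, and v^{(n)} → v pointwise a.e. on Ω, then F_{ε_n}(v^{(n)}) → F_0(v). -/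
open MeasureTheory

/-- The plane `ℝ²`, with the Euclidean norm and Lebesgue measure. -/
abbrev Plane : Type := EuclideanSpace ℝ (Fin 2)

/-- The Gaussian kernel `G_σ(x) = (1/(2πσ²)) exp(−‖x‖²/(2σ²))` on `ℝ²`. -/
noncomputable def gaussKer (σ : ℝ) (x : Plane) : ℝ :=
  (1 / (2 * Real.pi * σ ^ 2)) * Real.exp (-‖x‖ ^ 2 / (2 * σ ^ 2))

/-- The convolution `(G_σ * w)(x) = ∫_{ℝ²} G_σ(x−y) w(y) dy`. -/
noncomputable def gaussConv (σ : ℝ) (w : Plane → ℝ) (x : Plane) : ℝ :=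
  ∫ y : Plane, gaussKer σ (x - y) * w y

/-- The constraint set `S` of the relaxed Potts model:
each `v_k` is measurable and nonnegative a.e. on `Ω`, and the `v_k` sum to `1` a.e. on `Ω`. -/
def pottsAdmissible (Ω : Set Plane) (K : ℕ) (v : Fin K → Plane → ℝ) : Prop :=
  (∀ k, Measurable (v k)) ∧
    (∀ k, ∀ᵐ x ∂(volume.restrict Ω), 0 ≤ v k x) ∧
    (∀ᵐ x ∂(volume.restrict Ω), ∑ k, v k x = 1)

/-- The regularized Potts functional
`F_ε(v) = Σ_k [ ∫_Ω v_k f_k + ε ∫_Ω v_k ln v_k + (λ/2) ∫_Ω v_k (G_σ * (1_Ω − v_k)) ]`,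
each `v_k` extended by zero outside `Ω` in the convolution.  (`Real.log 0 = 0` implements
the convention `0·ln 0 = 0`.) -/
noncomputable def pottsFeps (Ω : Set Plane) (K : ℕ) (f : Fin K → Plane → ℝ)
    (lam σ ε : ℝ) (v : Fin K → Plane → ℝ) : ℝ :=
  ∑ k : Fin K,
    ((∫ x in Ω, v k x * f k x)
      + ε * (∫ x in Ω, v k x * Real.log (v k x))
      + (lam / 2) * ∫ x in Ω, v k x * gaussConv σ (Ω.indicator fun z => 1 - v k z) x)

/-- Components of an admissible tuple are at most `1` almost everywhere. -/
theorem pottsAdmissible.ae_mem_Icc {Ω : Set Plane} {K : ℕ} {v : Fin K → Plane → ℝ}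
    (hv : pottsAdmissible Ω K v) (k : Fin K) :
    ∀ᵐ x ∂(volume.restrict Ω), v k x ∈ Set.Icc (0 : ℝ) 1 := by
  filter_upwards [ae_all_iff.2 hv.2.1, hv.2.2] with x hx hsum
  exact ⟨hx k, hsum ▸ Finset.single_le_sum (f := fun j => v j x) (fun j _ => hx j)
    (Finset.mem_univ k)⟩

theorem continuous_gaussKer (σ : ℝ) : Continuous (gaussKer σ) := by
  unfold gaussKer
  fun_prop

theorem abs_gaussKer_le (σ : ℝ) (x : Plane) :
    |gaussKer σ x| ≤ 1 / (2 * Real.pi * σ ^ 2) := by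
  have hC : 0 ≤ 1 / (2 * Real.pi * σ ^ 2) := by positivity
  have hexp : Real.exp (-‖x‖ ^ 2 / (2 * σ ^ 2)) ≤ 1 := by
    rw [Real.exp_le_one_iff, neg_div]
    exact neg_nonpos.2 (by positivity)
  rw [gaussKer, abs_of_nonneg (mul_nonneg hC (Real.exp_pos _).le)]
  exact mul_le_of_le_one_right hC hexp

theorem stronglyMeasurable_gaussConv (σ : ℝ) {w : Plane → ℝ} (hw : Measurable w) :
    StronglyMeasurable (gaussConv σ w) := by
  refine StronglyMeasurable.integral_prod_right'
    (f := fun p : Plane × Plane => gaussKer σ (p.1 - p.2) * w p.2) ?_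
  have hG := (continuous_gaussKer σ).measurable
  exact Measurable.stronglyMeasurable (by fun_prop)

theorem gaussConv_indicator (σ : ℝ) {Ω : Set Plane} (hΩ : MeasurableSet Ω) (w : Plane → ℝ)
    (x : Plane) : gaussConv σ (Ω.indicator w) x = ∫ y in Ω, gaussKer σ (x - y) * w y := by
  rw [gaussConv, ← integral_indicator hΩ]
  congr 1 with y
  by_cases hy : y ∈ Ω <;> simp [hy]

theorem abs_gaussKer_mul_le (σ : ℝ) (x : Plane) {t : ℝ} (ht : t ∈ Set.Icc (0 : ℝ) 1) :
    ‖gaussKer σ x * (1 - t)‖ ≤ 1 / (2 * Real.pi * σ ^ 2) := by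
  rw [norm_mul]
  have h : ‖1 - t‖ ≤ 1 := abs_le.2 ⟨by linarith [ht.2], by linarith [ht.1]⟩
  exact (mul_le_of_le_one_right (norm_nonneg _) h).trans (abs_gaussKer_le σ x)

theorem abs_gaussConv_le (σ : ℝ) {Ω : Set Plane} (hΩ : MeasurableSet Ω) (hΩfin : volume Ω < ⊤)
    {w : Plane → ℝ} (hw : ∀ᵐ x ∂(volume.restrict Ω), w x ∈ Set.Icc (0 : ℝ) 1) (x : Plane) :
    ‖gaussConv σ (Ω.indicator fun z => 1 - w z) x‖
      ≤ 1 / (2 * Real.pi * σ ^ 2) * volume.real Ω := by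
  rw [gaussConv_indicator σ hΩ]
  exact norm_setIntegral_le_of_norm_le_const_ae' hΩfin
    ((ae_restrict_iff' hΩ).1 (hw.mono fun y hy => abs_gaussKer_mul_le σ (x - y) hy))

theorem tendsto_gaussConv (σ : ℝ) {Ω : Set Plane} (hΩ : MeasurableSet Ω) (hΩfin : volume Ω < ⊤)
    {w : ℕ → Plane → ℝ} {u : Plane → ℝ} (hmeas : ∀ n, Measurable (w n))
    (hw : ∀ n, ∀ᵐ x ∂(volume.restrict Ω), w n x ∈ Set.Icc (0 : ℝ) 1)
    (hconv : ∀ᵐ x ∂(volume.restrict Ω),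
      Filter.Tendsto (fun n => w n x) Filter.atTop (nhds (u x))) (x : Plane) :
    Filter.Tendsto (fun n => gaussConv σ (Ω.indicator fun z => 1 - w n z) x) Filter.atTop
      (nhds (gaussConv σ (Ω.indicator fun z => 1 - u z) x)) := by
  simp only [gaussConv_indicator σ hΩ]
  refine tendsto_integral_of_dominated_convergence (fun _ => 1 / (2 * Real.pi * σ ^ 2))
    (fun n => ?_) (integrableOn_const hΩfin.ne) (fun n => ?_) ?_
  · have hG := (continuous_gaussKer σ).measurable
    have hn := hmeas n
    exact Measurable.aestronglyMeasurable (by fun_prop)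
  · exact (hw n).mono fun y hy => abs_gaussKer_mul_le σ (x - y) hy
  · exact hconv.mono fun y hy => (hy.const_sub 1).const_mul _

theorem abs_mul_log_le_one {t : ℝ} (ht : t ∈ Set.Icc (0 : ℝ) 1) : ‖t * Real.log t‖ ≤ 1 := by
  rcases ht.1.eq_or_lt with h | h
  · simp [← h]
  · rw [mul_comm]
    exact (Real.abs_log_mul_self_lt t h ht.2).le

/-- **Continuous convergence of the regularized Potts functionals (the Γ-convergence step in
the proof of Lemma `lem.limit`):** if `ε_n → 0` and `v⁽ⁿ⁾ → v` pointwise a.e. on `Ω` within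
the constraint set `S`, then `F_{ε_n}(v⁽ⁿ⁾) → F_0(v)`. -/
theorem pottsFeps_tendsto
    (Ω : Set Plane) (hΩ : MeasurableSet Ω)
    (hΩ0 : 0 < volume Ω) (hΩfin : volume Ω < ⊤)
    (K : ℕ) (hK : 2 ≤ K)
    (f : Fin K → Plane → ℝ)
    (hf_meas : ∀ k, Measurable (f k))
    (hf_int : ∀ k, IntegrableOn (f k) Ω)
    (hf_nonneg : ∀ k, ∀ᵐ x ∂(volume.restrict Ω), 0 ≤ f k x)
    (lam σ : ℝ) (hlam : 0 < lam) (hσ : 0 < σ)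
    (eps : ℕ → ℝ) (heps_nonneg : ∀ n, 0 ≤ eps n)
    (heps : Filter.Tendsto eps Filter.atTop (nhds 0))
    (vseq : ℕ → Fin K → Plane → ℝ) (hvseq : ∀ n, pottsAdmissible Ω K (vseq n))
    (v : Fin K → Plane → ℝ) (hv : pottsAdmissible Ω K v)
    (hconv : ∀ᵐ x ∂(volume.restrict Ω), ∀ k,
      Filter.Tendsto (fun n => vseq n k x) Filter.atTop (nhds (v k x))) :
    Filter.Tendsto (fun n => pottsFeps Ω K f lam σ (eps n) (vseq n))
      Filter.atTop (nhds (pottsFeps Ω K f lam σ 0 v)) := by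
  have hb : ∀ n k, ∀ᵐ x ∂(volume.restrict Ω), vseq n k x ∈ Set.Icc (0 : ℝ) 1 :=
    fun n k => (hvseq n).ae_mem_Icc k
  have hm : ∀ n k, Measurable (vseq n k) := fun n k => (hvseq n).1 k
  have hlim := fun k => hconv.mono fun x hx => hx k
  unfold pottsFeps
  refine tendsto_finsetSum _ fun k _ => ((?_ : Filter.Tendsto _ _ _).add
    (heps.mul ?_)).add (Filter.Tendsto.const_mul _ ?_)
  · refine tendsto_integral_of_dominated_convergence (fun x => f k x)
      (fun n => ((hm n k).mul (hf_meas k)).aestronglyMeasurable) (hf_int k) (fun n => ?_) ?_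
    · filter_upwards [hb n k, hf_nonneg k] with x hx hfx
      rw [Real.norm_of_nonneg (mul_nonneg hx.1 hfx)]
      exact mul_le_of_le_one_left hfx hx.2
    · exact (hlim k).mono fun x hx => hx.mul_const _
  · refine tendsto_integral_of_dominated_convergence (fun _ => 1)
      (fun n => ((hm n k).mul (hm n k).log).aestronglyMeasurable)
      (integrableOn_const hΩfin.ne) (fun n => ?_) ?_
    · exact (hb n k).mono fun x hx => abs_mul_log_le_one hx
    · exact (hlim k).mono fun x hx => (Real.continuous_mul_log.tendsto _).comp hx
  · refine tendsto_integral_of_dominated_convergence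
      (fun _ => 1 / (2 * Real.pi * σ ^ 2) * volume.real Ω)
      (fun n => ?_) (integrableOn_const hΩfin.ne) (fun n => ?_) ?_
    · exact (hm n k).aestronglyMeasurable.mul (stronglyMeasurable_gaussConv σ
        ((measurable_const.sub (hm n k)).indicator hΩ)).aestronglyMeasurable
    · filter_upwards [hb n k] with x hx
      rw [norm_mul, Real.norm_of_nonneg hx.1]
      exact (mul_le_of_le_one_left (norm_nonneg _) hx.2).trans
        (abs_gaussConv_le σ hΩ hΩfin (hb n k) x)
    · exact (hlim k).mono fun x hx => hx.mul
        (tendsto_gaussConv σ hΩ hΩfin (fun n => hm n k) (fun n => hb n k) (hlim k) x)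
end
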